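/- Let n > 0 and let L be an n-modular lattice (not necessarily bounded). Then M₃[L] is a lattice, the map ψ : x ↦ (x, x, x) is a lattice embedding of L into M₃[L], and M₃[L] is a congruence-preserving extension of ψ(L): for every congruence Θ of L there is exactly one congruence Φ of M₃[L] such that ψ(x) Φ ψ(y) if and only if x Θ y, for all x, y ∈ L. -/

import Mathlib

/-- A triple `(x, y, z)` in a lattice is *balanced* if `x ⊓ y = x ⊓ z = y ⊓ z`. -/
def IsBalanced {α : Type*} [Lattice α] (t : α × α × α) : Prop :=
  t.1 ⊓ t.2.1 = t.1 ⊓ t.2.2 ∧ t.1 ⊓ t.2.2 = t.2.1 ⊓ t.2.2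

/-- One step of the balancing sequence; `adjT^[n] (x,y,z) = (pₙ, qₙ, rₙ)` at `(x,y,z)`. -/
def adjT {α : Type*} [Lattice α] (t : α × α × α) : α × α × α :=
  (t.1 ⊔ t.2.1 ⊓ t.2.2, t.2.1 ⊔ t.1 ⊓ t.2.2, t.2.2 ⊔ t.1 ⊓ t.2.1)

/-- A lattice is `n`-modular (satisfies the identity `γₙ : pₙ = pₙ₊₁`). -/
def NModular (α : Type*) [Lattice α] (n : ℕ) : Prop :=
  ∀ t : α × α × α, (adjT^[n] t).1 = (adjT^[n + 1] t).1

/-- A congruence of a lattice: an equivalence relation with the substitution properties. -/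
def IsLatCon {α : Type*} [Lattice α] (Θ : α → α → Prop) : Prop :=
  Equivalence Θ ∧ (∀ a b c, Θ a b → Θ (a ⊔ c) (b ⊔ c)) ∧
    (∀ a b c, Θ a b → Θ (a ⊓ c) (b ⊓ c))

/-- A congruence of a poset-which-is-a-lattice, stated order-theoretically: an equivalence
relation with the substitution property for binary joins (least upper bounds) and binary
meets (greatest lower bounds). -/
def IsConP {β : Type*} [PartialOrder β] (Θ : β → β → Prop) : Prop :=
  Equivalence Θ ∧
  (∀ a b c s t, Θ a b → IsLUB {a, c} s → IsLUB {b, c} t → Θ s t) ∧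
  (∀ a b c s t, Θ a b → IsGLB {a, c} s → IsGLB {b, c} t → Θ s t)

/-- The diagonal map `ψ : x ↦ (x, x, x)` from `L` into `M₃[L]`. -/
def psiM3 {α : Type*} [Lattice α] (x : α) : {t : α × α × α // IsBalanced t} :=
  ⟨(x, x, x), by simp [IsBalanced]⟩

section BalancedTriples

variable {α : Type*} [Lattice α]

theorem isBalanced_iff_adjT_eq {t : α × α × α} : IsBalanced t ↔ adjT t = t := by
  obtain ⟨x, y, z⟩ := t
  simp only [IsBalanced, adjT, Prod.mk.injEq, sup_eq_left]
  constructor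
  · rintro ⟨h₁, h₂⟩
    exact ⟨h₂ ▸ inf_le_left, h₁ ▸ inf_le_right, h₁ ▸ inf_le_right⟩
  · rintro ⟨h₁, h₂, h₃⟩
    exact ⟨le_antisymm (le_inf inf_le_left h₃) (le_inf inf_le_left h₂),
      le_antisymm (le_inf h₂ inf_le_right) (le_inf h₁ inf_le_right)⟩

theorem monotone_adjT : Monotone (adjT (α := α)) := by
  rintro ⟨x, y, z⟩ ⟨x', y', z'⟩ ⟨h₁, h₂, h₃⟩
  exact ⟨sup_le_sup h₁ (inf_le_inf h₂ h₃), sup_le_sup h₂ (inf_le_inf h₁ h₃),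
    sup_le_sup h₃ (inf_le_inf h₁ h₂)⟩

theorem le_adjT (t : α × α × α) : t ≤ adjT t :=
  ⟨le_sup_left, le_sup_left, le_sup_left⟩

theorem IsBalanced.inf {s t : α × α × α} (hs : IsBalanced s) (ht : IsBalanced t) :
    IsBalanced (s ⊓ t) := by
  simp only [IsBalanced, Prod.fst_inf, Prod.snd_inf] at *
  rw [inf_inf_inf_comm s.1 t.1 s.2.1, inf_inf_inf_comm s.1 t.1 s.2.2,
    inf_inf_inf_comm s.2.1 t.2.1, hs.1, hs.2, ht.1, ht.2]
  exact ⟨rfl, rfl⟩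

/-- `n`-modularity says that `n` balancing steps produce a balanced triple. -/
theorem NModular.isBalanced_iterate {n : ℕ} (h : NModular α n) (t : α × α × α) :
    IsBalanced (adjT^[n] t) := by
  have swap₁₂ : Function.Semiconj (fun t : α × α × α ↦ (t.2.1, t.1, t.2.2)) adjT adjT :=
    fun t ↦ by simp [adjT, inf_comm]
  have swap₁₃ : Function.Semiconj (fun t : α × α × α ↦ (t.2.2, t.2.1, t.1)) adjT adjT :=
    fun t ↦ by simp [adjT, inf_comm]
  rw [isBalanced_iff_adjT_eq, ← Function.iterate_succ_apply' adjT]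
  refine Prod.ext (h t).symm (Prod.ext ?_ ?_)
  · have := h (t.2.1, t.1, t.2.2)
    rw [← (swap₁₂.iterate_right n).eq, ← (swap₁₂.iterate_right (n + 1)).eq] at this
    exact this.symm
  · have := h (t.2.2, t.2.1, t.1)
    rw [← (swap₁₃.iterate_right n).eq, ← (swap₁₃.iterate_right (n + 1)).eq] at this
    exact this.symm

theorem isLUB_of_eq_iterate_adjT (k : ℕ) {s t u : {t : α × α × α // IsBalanced t}}
    (hu : u.1 = adjT^[k] (s.1 ⊔ t.1)) : IsLUB {s, t} u := by
  have hle : s.1 ⊔ t.1 ≤ u.1 := hu ▸ Function.id_le_iterate_of_id_le le_adjT k _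
  refine ⟨?_, fun v hv ↦ ?_⟩
  · rintro _ (rfl | rfl)
    exacts [le_sup_left.trans hle, le_sup_right.trans hle]
  · have hsup : s.1 ⊔ t.1 ≤ v.1 :=
      sup_le (hv (Set.mem_insert _ _)) (hv (Set.mem_insert_of_mem _ rfl))
    change u.1 ≤ v.1
    rw [hu, ← Function.iterate_fixed (isBalanced_iff_adjT_eq.1 v.2) k]
    exact monotone_adjT.iterate k hsup

theorem isGLB_of_eq_inf {s t u : {t : α × α × α // IsBalanced t}}
    (hu : u.1 = s.1 ⊓ t.1) : IsGLB {s, t} u := by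
  refine ⟨?_, fun v hv ↦ ?_⟩
  · rintro _ (rfl | rfl)
    exacts [hu.trans_le inf_le_left, hu.trans_le inf_le_right]
  · exact (le_inf (hv (Set.mem_insert _ _)) (hv (Set.mem_insert_of_mem _ rfl)) :
      v.1 ≤ s.1 ⊓ t.1).trans_eq hu.symm

/-- In an `n`-modular lattice the join of two balanced triples is the balancing of their
componentwise join. -/
theorem NModular.isLUB_iff {n : ℕ} (h : NModular α n)
    {s t u : {t : α × α × α // IsBalanced t}} :
    IsLUB {s, t} u ↔ u.1 = adjT^[n] (s.1 ⊔ t.1) := by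
  refine ⟨fun hu ↦ ?_, isLUB_of_eq_iterate_adjT n⟩
  have := hu.unique
    (isLUB_of_eq_iterate_adjT n (u := ⟨adjT^[n] (s.1 ⊔ t.1), h.isBalanced_iterate _⟩) rfl)
  rw [this]

theorem isGLB_iff_eq_inf {s t u : {t : α × α × α // IsBalanced t}} :
    IsGLB {s, t} u ↔ u.1 = s.1 ⊓ t.1 := by
  refine ⟨fun hu ↦ ?_, isGLB_of_eq_inf⟩
  have := hu.unique (isGLB_of_eq_inf (u := ⟨s.1 ⊓ t.1, s.2.inf t.2⟩) rfl)
  rw [this]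

theorem IsLatCon.sup {Θ : α → α → Prop} (hΘ : IsLatCon Θ) {a b c d : α}
    (hab : Θ a b) (hcd : Θ c d) : Θ (a ⊔ c) (b ⊔ d) := by
  refine hΘ.1.trans (hΘ.2.1 _ _ _ hab) ?_
  rw [sup_comm b c, sup_comm b d]
  exact hΘ.2.1 _ _ _ hcd

theorem IsLatCon.inf {Θ : α → α → Prop} (hΘ : IsLatCon Θ) {a b c d : α}
    (hab : Θ a b) (hcd : Θ c d) : Θ (a ⊓ c) (b ⊓ d) := by
  refine hΘ.1.trans (hΘ.2.2 _ _ _ hab) ?_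
  rw [inf_comm b c, inf_comm b d]
  exact hΘ.2.2 _ _ _ hcd

/-- The componentwise extension of a relation to triples. -/
def TripleRel (Θ : α → α → Prop) (s t : α × α × α) : Prop :=
  Θ s.1 t.1 ∧ Θ s.2.1 t.2.1 ∧ Θ s.2.2 t.2.2

theorem TripleRel.adjT {Θ : α → α → Prop} (hΘ : IsLatCon Θ) {s t : α × α × α}
    (hst : TripleRel Θ s t) : TripleRel Θ (adjT s) (adjT t) :=
  ⟨hΘ.sup hst.1 (hΘ.inf hst.2.1 hst.2.2), hΘ.sup hst.2.1 (hΘ.inf hst.1 hst.2.2),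
    hΘ.sup hst.2.2 (hΘ.inf hst.1 hst.2.1)⟩

theorem TripleRel.iterate_adjT {Θ : α → α → Prop} (hΘ : IsLatCon Θ) {s t : α × α × α}
    (hst : TripleRel Θ s t) (k : ℕ) : TripleRel Θ (_root_.adjT^[k] s) (_root_.adjT^[k] t) := by
  induction k with
  | zero => exact hst
  | succ k ih =>
    rw [Function.iterate_succ_apply', Function.iterate_succ_apply']
    exact ih.adjT hΘ

theorem isConP_tripleRel {n : ℕ} (h : NModular α n) {Θ : α → α → Prop} (hΘ : IsLatCon Θ) :
    IsConP fun s t : {t : α × α × α // IsBalanced t} ↦ TripleRel Θ s.1 t.1 := by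
  have hr := hΘ.1.refl
  refine ⟨⟨fun _ ↦ ⟨hr _, hr _, hr _⟩,
    fun ⟨h₁, h₂, h₃⟩ ↦ ⟨hΘ.1.symm h₁, hΘ.1.symm h₂, hΘ.1.symm h₃⟩,
    fun ⟨h₁, h₂, h₃⟩ ⟨k₁, k₂, k₃⟩ ↦
      ⟨hΘ.1.trans h₁ k₁, hΘ.1.trans h₂ k₂, hΘ.1.trans h₃ k₃⟩⟩, ?_, ?_⟩
  · intro a b c s t hab hs ht
    simp only [h.isLUB_iff.1 hs, h.isLUB_iff.1 ht]
    exact TripleRel.iterate_adjT hΘ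
      ⟨hΘ.2.1 _ _ _ hab.1, hΘ.2.1 _ _ _ hab.2.1, hΘ.2.1 _ _ _ hab.2.2⟩ n
  · intro a b c s t hab hs ht
    simp only [isGLB_iff_eq_inf.1 hs, isGLB_iff_eq_inf.1 ht]
    exact ⟨hΘ.2.2 _ _ _ hab.1, hΘ.2.2 _ _ _ hab.2.1, hΘ.2.2 _ _ _ hab.2.2⟩

theorem IsConP.sup {β : Type*} [PartialOrder β] {Φ : β → β → Prop} (hΦ : IsConP Φ)
    (hex : ∀ a b : β, ∃ s, IsLUB {a, b} s) {a b c d s t : β} (hab : Φ a b) (hcd : Φ c d)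
    (hs : IsLUB {a, c} s) (ht : IsLUB {b, d} t) : Φ s t := by
  obtain ⟨u, hu⟩ := hex b c
  exact hΦ.1.trans (hΦ.2.1 _ _ _ _ _ hab hs hu)
    (hΦ.2.1 _ _ _ _ _ hcd (Set.pair_comm b c ▸ hu) (Set.pair_comm b d ▸ ht))

/-- The balanced triple `(x, o, o)`. -/
def axisFst {o x : α} (hx : o ≤ x) : {t : α × α × α // IsBalanced t} :=
  ⟨(x, o, o), by simp [IsBalanced, hx]⟩

/-- The balanced triple `(o, x, o)`. -/
def axisSnd {o x : α} (hx : o ≤ x) : {t : α × α × α // IsBalanced t} :=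
  ⟨(o, x, o), by simp [IsBalanced, hx]⟩

/-- The balanced triple `(o, o, x)`. -/
def axisTrd {o x : α} (hx : o ≤ x) : {t : α × α × α // IsBalanced t} :=
  ⟨(o, o, x), by simp [IsBalanced, hx]⟩

section Perspectivity

variable {Φ : {t : α × α × α // IsBalanced t} → {t : α × α × α // IsBalanced t} → Prop}
  {o x y i : α} {hox : o ≤ x} {hoy : o ≤ y}

theorem IsConP.axisTrd_of_axisFst (hΦ : IsConP Φ) (hxi : x ≤ i) (hyi : y ≤ i)
    (hxy : Φ (axisFst hox) (axisFst hoy)) : Φ (axisTrd hox) (axisTrd hoy) := by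
  have hoi := hox.trans hxi
  refine hΦ.2.2 ⟨(x, i, x), by simp [IsBalanced, hxi]⟩ ⟨(y, i, y), by simp [IsBalanced, hyi]⟩
    (axisTrd hoi) _ _ (hΦ.2.1 _ _ (axisSnd hoi) _ _ hxy (isLUB_of_eq_iterate_adjT 1 ?_)
      (isLUB_of_eq_iterate_adjT 1 ?_)) (isGLB_of_eq_inf ?_) (isGLB_of_eq_inf ?_) <;>
  simp [axisFst, axisSnd, axisTrd, adjT, *]

theorem IsConP.axisFst_of_axisTrd (hΦ : IsConP Φ) (hxi : x ≤ i) (hyi : y ≤ i)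
    (hxy : Φ (axisTrd hox) (axisTrd hoy)) : Φ (axisFst hox) (axisFst hoy) := by
  have hoi := hox.trans hxi
  refine hΦ.2.2 ⟨(x, i, x), by simp [IsBalanced, hxi]⟩ ⟨(y, i, y), by simp [IsBalanced, hyi]⟩
    (axisFst hoi) _ _ (hΦ.2.1 _ _ (axisSnd hoi) _ _ hxy (isLUB_of_eq_iterate_adjT 1 ?_)
      (isLUB_of_eq_iterate_adjT 1 ?_)) (isGLB_of_eq_inf ?_) (isGLB_of_eq_inf ?_) <;>
  simp [axisFst, axisSnd, axisTrd, adjT, *]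

theorem IsConP.axisFst_of_axisSnd (hΦ : IsConP Φ) (hxi : x ≤ i) (hyi : y ≤ i)
    (hxy : Φ (axisSnd hox) (axisSnd hoy)) : Φ (axisFst hox) (axisFst hoy) := by
  have hoi := hox.trans hxi
  refine hΦ.2.2 ⟨(x, x, i), by simp [IsBalanced, hxi]⟩ ⟨(y, y, i), by simp [IsBalanced, hyi]⟩
    (axisFst hoi) _ _ (hΦ.2.1 _ _ (axisTrd hoi) _ _ hxy (isLUB_of_eq_iterate_adjT 1 ?_)
      (isLUB_of_eq_iterate_adjT 1 ?_)) (isGLB_of_eq_inf ?_) (isGLB_of_eq_inf ?_) <;>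
  simp [axisFst, axisSnd, axisTrd, adjT, *]

theorem IsConP.psiM3_of_axisFst (hΦ : IsConP Φ)
    (hex : ∀ a b : {t : α × α × α // IsBalanced t}, ∃ s, IsLUB {a, b} s)
    (hxi : x ≤ i) (hyi : y ≤ i) (hxy : Φ (axisFst hox) (axisFst hoy)) :
    Φ (psiM3 x) (psiM3 y) := by
  refine hΦ.sup hex hxy (hΦ.axisTrd_of_axisFst hxi hyi hxy)
    (isLUB_of_eq_iterate_adjT 1 ?_) (isLUB_of_eq_iterate_adjT 1 ?_) <;>
  simp [axisFst, axisTrd, psiM3, adjT, *]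

end Perspectivity

/-- A congruence of `M₃[L]` is determined componentwise by its restriction to the diagonal. -/
theorem IsConP.iff_tripleRel
    {Φ : {t : α × α × α // IsBalanced t} → {t : α × α × α // IsBalanced t} → Prop}
    (hΦ : IsConP Φ) (hex : ∀ a b : {t : α × α × α // IsBalanced t}, ∃ s, IsLUB {a, b} s)
    (a b : {t : α × α × α // IsBalanced t}) :
    Φ a b ↔ TripleRel (fun x y ↦ Φ (psiM3 x) (psiM3 y)) a.1 b.1 := by
  obtain ⟨⟨a₁, a₂, a₃⟩, ha⟩ := a
  obtain ⟨⟨b₁, b₂, b₃⟩, hb⟩ := b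
  obtain ⟨o, ⟨ha₁, ha₂, ha₃⟩, hb₁, hb₂, hb₃⟩ :
      ∃ o, (o ≤ a₁ ∧ o ≤ a₂ ∧ o ≤ a₃) ∧ o ≤ b₁ ∧ o ≤ b₂ ∧ o ≤ b₃ :=
    ⟨(a₁ ⊓ (a₂ ⊓ a₃)) ⊓ (b₁ ⊓ (b₂ ⊓ b₃)), by
      simpa only [le_inf_iff] using le_refl ((a₁ ⊓ (a₂ ⊓ a₃)) ⊓ (b₁ ⊓ (b₂ ⊓ b₃)))⟩
  obtain ⟨i, ⟨ha₁', ha₂', ha₃'⟩, hb₁', hb₂', hb₃'⟩ :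
      ∃ i, (a₁ ≤ i ∧ a₂ ≤ i ∧ a₃ ≤ i) ∧ b₁ ≤ i ∧ b₂ ≤ i ∧ b₃ ≤ i :=
    ⟨(a₁ ⊔ (a₂ ⊔ a₃)) ⊔ (b₁ ⊔ (b₂ ⊔ b₃)), by
      simpa only [sup_le_iff] using le_refl ((a₁ ⊔ (a₂ ⊔ a₃)) ⊔ (b₁ ⊔ (b₂ ⊔ b₃)))⟩
  have hoi := ha₁.trans ha₁'
  constructor
  · intro hab
    have h₁ : Φ (axisFst ha₁) (axisFst hb₁) := by
      refine hΦ.2.2 _ _ (axisFst hoi) _ _ hab (isGLB_of_eq_inf ?_) (isGLB_of_eq_inf ?_) <;>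
      simp [axisFst, *]
    have h₂ : Φ (axisSnd ha₂) (axisSnd hb₂) := by
      refine hΦ.2.2 _ _ (axisSnd hoi) _ _ hab (isGLB_of_eq_inf ?_) (isGLB_of_eq_inf ?_) <;>
      simp [axisSnd, *]
    have h₃ : Φ (axisTrd ha₃) (axisTrd hb₃) := by
      refine hΦ.2.2 _ _ (axisTrd hoi) _ _ hab (isGLB_of_eq_inf ?_) (isGLB_of_eq_inf ?_) <;>
      simp [axisTrd, *]
    exact ⟨hΦ.psiM3_of_axisFst hex ha₁' hb₁' h₁,
      hΦ.psiM3_of_axisFst hex ha₂' hb₂' (hΦ.axisFst_of_axisSnd ha₂' hb₂' h₂),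
      hΦ.psiM3_of_axisFst hex ha₃' hb₃' (hΦ.axisFst_of_axisTrd ha₃' hb₃' h₃)⟩
  · rintro ⟨h₁, h₂, h₃⟩
    have k₁ : Φ (axisFst ha₁) (axisFst hb₁) := by
      refine hΦ.2.2 _ _ (axisFst hoi) _ _ h₁ (isGLB_of_eq_inf ?_) (isGLB_of_eq_inf ?_) <;>
      simp [axisFst, psiM3, *]
    have k₂ : Φ (axisSnd ha₂) (axisSnd hb₂) := by
      refine hΦ.2.2 _ _ (axisSnd hoi) _ _ h₂ (isGLB_of_eq_inf ?_) (isGLB_of_eq_inf ?_) <;>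
      simp [axisSnd, psiM3, *]
    have k₃ : Φ (axisTrd ha₃) (axisTrd hb₃) := by
      refine hΦ.2.2 _ _ (axisTrd hoi) _ _ h₃ (isGLB_of_eq_inf ?_) (isGLB_of_eq_inf ?_) <;>
      simp [axisTrd, psiM3, *]
    have k₁₂ : Φ ⟨(a₁, a₂, a₁ ⊓ a₂), by simp [IsBalanced]⟩
        ⟨(b₁, b₂, b₁ ⊓ b₂), by simp [IsBalanced]⟩ := by
      refine hΦ.sup hex k₁ k₂ (isLUB_of_eq_iterate_adjT 1 ?_)
        (isLUB_of_eq_iterate_adjT 1 ?_) <;>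
      simp [axisFst, axisSnd, adjT, *]
    have ha₁₂ : a₁ ⊓ a₂ ≤ a₃ := ha.1.trans_le inf_le_right
    have hb₁₂ : b₁ ⊓ b₂ ≤ b₃ := hb.1.trans_le inf_le_right
    refine hΦ.sup hex k₁₂ k₃ (isLUB_of_eq_iterate_adjT 0 ?_)
      (isLUB_of_eq_iterate_adjT 0 ?_) <;>
    simp [axisTrd, *]

end BalancedTriples

/-- Let `n > 0` and let `L` be an `n`-modular lattice (not necessarily bounded).  Then
`M₃[L]` is a lattice, `ψ : x ↦ (x, x, x)` is a lattice embedding of `L` into `M₃[L]`, and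
`M₃[L]` is a congruence-preserving extension of `ψ(L)`: every congruence `Θ` of `L` has
exactly one extension to a congruence `Φ` of `M₃[L]` with `Φ (ψ x) (ψ y) ↔ Θ x y`. -/
theorem stmt9 {α : Type*} [Lattice α] (n : ℕ) (hn : 0 < n) (h : NModular α n)
    (Θ : α → α → Prop) (hΘ : IsLatCon Θ) :
    (∀ a b : {t : α × α × α // IsBalanced t}, ∃ s, IsLUB {a, b} s) ∧
    (∀ a b : {t : α × α × α // IsBalanced t}, ∃ m, IsGLB {a, b} m) ∧
    Function.Injective (psiM3 (α := α)) ∧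
    (∀ x y : α, IsLUB {psiM3 x, psiM3 y} (psiM3 (x ⊔ y)) ∧
       IsGLB {psiM3 x, psiM3 y} (psiM3 (x ⊓ y))) ∧
    (∃! Φ : {t : α × α × α // IsBalanced t} → {t : α × α × α // IsBalanced t} → Prop,
      IsConP Φ ∧ ∀ x y : α, Φ (psiM3 x) (psiM3 y) ↔ Θ x y) := by
 
  have hex : ∀ a b : {t : α × α × α // IsBalanced t}, ∃ s, IsLUB {a, b} s := fun a b ↦
    ⟨⟨adjT^[n] (a.1 ⊔ b.1), h.isBalanced_iterate _⟩, isLUB_of_eq_iterate_adjT n rfl⟩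
  refine ⟨hex, fun a b ↦ ⟨⟨a.1 ⊓ b.1, a.2.inf b.2⟩, isGLB_of_eq_inf rfl⟩,
    fun x y hxy ↦ congrArg (fun t ↦ t.1.1) hxy,
    fun x y ↦ ⟨isLUB_of_eq_iterate_adjT 0 rfl, isGLB_of_eq_inf rfl⟩,
    fun s t ↦ TripleRel Θ s.1 t.1,
    ⟨isConP_tripleRel h hΘ, fun x y ↦ ⟨fun hxy ↦ hxy.1, fun hxy ↦ ⟨hxy, hxy, hxy⟩⟩⟩, ?_⟩
  rintro Φ ⟨hΦ, hΦΘ⟩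
  funext a b
  simp only [hΦ.iff_tripleRel hex a b, hΦΘ]
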